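/- (Proposition 4.) Fix an integer m ≥ 2 and λ > 0. Let μ₀ be a Borel probability measure on ℝ such that ∫ e^{s x} dμ₀(x) < ∞ for all s in some open neighborhood of 0 and ∫ x dμ₀(x) > 0. Let b : ℕ → ℝ be defined by b(1) = 1 and, for n > 1, b(n) = (m−1)^{−1} ( 1 − Σ_{(i₁,…,i_{m−1}): each i_k < n, Σ i_k = n+m−2} ∏_{k=1}^{m−1} b(i_k) ), and for t ≥ 0 let μ_t = Σ_{n≥1} b(n) e^{−λt}(1−e^{−(m−1)λt})^{n−1} μ₀^{*[(m−1)(n−1)+1]}. Then for every a ∈ ℝ there exists a constant κ > 0 such that for all t ≥ 0: e^{−λt} μ₀((−∞, a)) ≤ μ_t((−∞, a)) ≤ κ^{1/(m−1)} e^{−λt}. In particular, the rate of exponential convergence is λ, independent of the meeting group size m. -/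

import Mathlib

open MeasureTheory

/-- `n`-fold convolution power of a measure on `ℝ`: `convPow μ 0 = δ₀` and
`convPow μ (n+1) = (convPow μ n) ∗ μ`. In particular `convPow μ 1 = δ₀ ∗ μ = μ`. -/
noncomputable def convPow (μ : Measure ℝ) : ℕ → Measure ℝ
  | 0 => Measure.dirac 0
  | n + 1 => Measure.conv (convPow μ n) μ

open PowerSeries in
theorem PowerSeries.coeff_pow_eq_sum_piAntidiag {R : Type*} [CommSemiring R] (f : PowerSeries R)
    (p n : ℕ) :
    coeff n (f ^ p) = ∑ j ∈ Finset.piAntidiag (Finset.univ : Finset (Fin p)) n,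
      ∏ k, coeff (j k) f := by
  have h : f ^ p = ∏ _k : Fin p, f := by simp
  rw [h, coeff_prod]
  refine Finset.sum_bij' (fun l _ => ⇑l) (fun j _ => Finsupp.equivFunOnFinite.symm j)
    ?_ ?_ ?_ ?_ ?_
  · intro l hl
    simpa [Finset.mem_finsuppAntidiag] using hl
  · intro j hj
    simpa [Finset.mem_finsuppAntidiag] using hj
  · intro l _
    ext k
    simp
  · intro j _
    ext k
    simp
  · intro l _
    rfl

/-- Separating the compositions of `N` that concentrate all their mass in a single slot. -/
theorem Finset.sum_piAntidiag_prod_eq_card_mul_add {R : Type*} [CommSemiring R] {p N : ℕ}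
    (hN : N ≠ 0) (c : ℕ → R) (hc : c 0 = 1) :
    ∑ j ∈ Finset.piAntidiag (Finset.univ : Finset (Fin p)) N, ∏ k, c (j k) =
      p * c N + ∑ j ∈ (Finset.piAntidiag (Finset.univ : Finset (Fin p)) N).filter
        (fun j => ∀ k, j k < N), ∏ k, c (j k) := by
  have hconc : (Finset.piAntidiag (Finset.univ : Finset (Fin p)) N).filter
      (fun j => ¬ ∀ k, j k < N) = Finset.univ.image (fun k : Fin p => Pi.single k N) := by
    ext j
    simp only [Finset.mem_filter, Finset.mem_piAntidiag, Finset.mem_univ, Finset.mem_image,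
      true_and, implies_true, and_true]
    constructor
    · rintro ⟨hs, hk⟩
      push Not at hk
      obtain ⟨k, hk⟩ := hk
      refine ⟨k, ?_⟩
      replace hs : ∑ l, j l = N := hs
      have hs' := Finset.add_sum_erase Finset.univ j (Finset.mem_univ k)
      have h0 : ∑ l ∈ Finset.univ.erase k, j l = 0 := by omega
      rw [Finset.sum_eq_zero_iff] at h0
      funext l
      by_cases hl : l = k
      · subst hl
        simp only [Pi.single_eq_same]
        omega
      · rw [Pi.single_eq_of_ne hl, h0 l (by simp [hl])]
    · rintro ⟨k, rfl⟩
      refine ⟨by simp, fun h => ?_⟩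
      simpa using h k
  rw [← Finset.sum_filter_not_add_sum_filter _ (fun j : Fin p → ℕ => ∀ k, j k < N), hconc,
    Finset.sum_image]
  · congr 1
    rw [Finset.sum_congr rfl (g := fun _ => c N), Finset.sum_const, Finset.card_univ,
      Fintype.card_fin, nsmul_eq_mul]
    intro k _
    rw [Finset.prod_eq_single k]
    · simp
    · intro l _ hl
      simp [Pi.single_eq_of_ne hl, hc]
    · simp
  · intro k _ l _ hkl
    by_contra hne
    have := congrFun hkl k
    simp [Pi.single_eq_of_ne hne] at this
    exact hN this

open PowerSeries in
/-- The coefficients of a power series root of `1 / (1 - X)` satisfy a two-term recursion. -/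
theorem PowerSeries.coeff_succ_of_pow_mul_one_sub_X_eq_one {K : Type*} [Field K] [CharZero K]
    {f : PowerSeries K} {p : ℕ} (hp : p ≠ 0) (hf : f ^ p * (1 - X) = 1) (n : ℕ) :
    p * (n + 1) * coeff (n + 1) f = (p * n + 1) * coeff n f := by
  have hf0 : f ≠ 0 := by
    rintro rfl
    simp [hp] at hf
  have hd := congrArg (derivative K) hf
  rw [Derivation.leibniz, derivative_pow, map_sub, derivative_X, derivative_one] at hd
  simp only [smul_eq_mul, zero_sub, mul_neg, mul_one] at hd
  have hmul : f ^ (p - 1) * ((p : PowerSeries K) * ((1 - X) * derivative K f) - f) = 0 := by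
    have hpow : f ^ p = f ^ (p - 1) * f := by
      rw [← pow_succ, Nat.sub_add_cancel (Nat.one_le_iff_ne_zero.2 hp)]
    rw [hpow] at hd
    linear_combination hd
  have hode : (p : PowerSeries K) * (derivative K f - X * derivative K f) = f := by
    linear_combination (mul_eq_zero.1 hmul).resolve_left (pow_ne_zero _ hf0)
  have hcoeff := congrArg (coeff n) hode
  rw [← map_natCast (C (R := K)), coeff_C_mul, map_sub, coeff_derivative] at hcoeff
  cases n with
  | zero =>
    simp at hcoeff ⊢
    linear_combination hcoeff
  | succ n =>
    rw [coeff_succ_X_mul, coeff_derivative] at hcoeff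
    push_cast at hcoeff ⊢
    linear_combination hcoeff

/-- The Wild sum weights are nonnegative: they are the coefficients of
`(1 - X) ^ (-1 / p)` with `p = m - 1`. -/
theorem wildWeight_nonneg {p : ℕ} (hp : p ≠ 0) {c : ℕ → ℝ} (hc0 : c 0 = 1)
    (hc : ∀ N ≠ 0, p * c N + ∑ j ∈ (Finset.piAntidiag (Finset.univ : Finset (Fin p)) N).filter
      (fun j => ∀ k, j k < N), ∏ k, c (j k) = 1) (n : ℕ) : 0 ≤ c n := by
  have hone : (PowerSeries.mk c) ^ p = PowerSeries.mk 1 := by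
    ext N
    rw [PowerSeries.coeff_pow_eq_sum_piAntidiag]
    simp only [PowerSeries.coeff_mk, Pi.one_apply]
    rcases eq_or_ne N 0 with rfl | hN
    · simp [hc0]
    · rw [Finset.sum_piAntidiag_prod_eq_card_mul_add hN c hc0, hc N hN]
  have hrec := PowerSeries.coeff_succ_of_pow_mul_one_sub_X_eq_one hp
    (by rw [hone, PowerSeries.mk_one_mul_one_sub_eq_one])
  simp only [PowerSeries.coeff_mk] at hrec
  have hp' : (0 : ℝ) < p := by exact_mod_cast Nat.pos_of_ne_zero hp
  induction n with
  | zero => simp [hc0]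
  | succ n ih =>
    have hpos : (0 : ℝ) < p * (n + 1) := by positivity
    refine nonneg_of_mul_nonneg_right (b := c (n + 1)) ?_ hpos
    rw [hrec n]
    positivity

theorem wildWeight_le_one {p : ℕ} (hp : p ≠ 0) {c : ℕ → ℝ} (hc0 : c 0 = 1)
    (hc : ∀ N ≠ 0, p * c N + ∑ j ∈ (Finset.piAntidiag (Finset.univ : Finset (Fin p)) N).filter
      (fun j => ∀ k, j k < N), ∏ k, c (j k) = 1) (n : ℕ) : c n ≤ 1 := by
  have hnn := wildWeight_nonneg hp hc0 hc
  rcases eq_or_ne n 0 with rfl | hn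
  · exact hc0.le
  have hsum : 0 ≤ ∑ j ∈ (Finset.piAntidiag (Finset.univ : Finset (Fin p)) n).filter
      (fun j => ∀ k, j k < n), ∏ k, c (j k) :=
    Finset.sum_nonneg fun j _ => Finset.prod_nonneg fun k _ => hnn _
  have hp' : (1 : ℝ) ≤ p := by exact_mod_cast Nat.one_le_iff_ne_zero.2 hp
  nlinarith [hc n hn, hnn n]

/-- The recursion over tuples of positive indices, shifted to tuples of natural numbers. -/
theorem wildWeight_shifted_recursion {m : ℕ} (hm : 2 ≤ m) {b : ℕ → ℝ}
    (hbrec : ∀ n > 1, b n =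
      ((m : ℝ) - 1)⁻¹ *
        (1 - ∑ i ∈ (Fintype.piFinset fun _ : Fin (m - 1) => Finset.Ico 1 n).filter
              (fun i => ∑ k, i k = n + m - 2),
            ∏ k, b (i k))) (N : ℕ) (hN : N ≠ 0) :
    (m - 1 : ℕ) * b (N + 1) +
      ∑ j ∈ (Finset.piAntidiag (Finset.univ : Finset (Fin (m - 1))) N).filter
        (fun j => ∀ k, j k < N), ∏ k, b (j k + 1) = 1 := by
  have hcast : ((m - 1 : ℕ) : ℝ) = m - 1 := by
    rw [Nat.cast_sub (by omega), Nat.cast_one]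
  have hne : (m : ℝ) - 1 ≠ 0 := by
    rw [← hcast]
    exact_mod_cast (by omega : m - 1 ≠ 0)
  rw [hcast, hbrec (N + 1) (by omega), mul_inv_cancel_left₀ hne, sub_add, sub_eq_self, sub_eq_zero]
  refine Finset.sum_bij' (fun i _ k => i k - 1) (fun j _ k => j k + 1) ?_ ?_ ?_ ?_ ?_
  · intro i hi
    simp only [Finset.mem_filter, Fintype.mem_piFinset, Finset.mem_Ico] at hi
    have hsum : ∑ k, (i k - 1) + ∑ _k : Fin (m - 1), 1 = ∑ k, i k := by
      rw [← Finset.sum_add_distrib]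
      exact Finset.sum_congr rfl fun k _ => Nat.sub_add_cancel (hi.1 k).1
    simp only [Finset.sum_const, Finset.card_univ, Fintype.card_fin, smul_eq_mul, mul_one] at hsum
    simp only [Finset.mem_filter, Finset.mem_piAntidiag, Finset.mem_univ, implies_true, and_true]
    refine ⟨by omega, fun k => ?_⟩
    have := hi.1 k
    omega
  · intro j hj
    simp only [Finset.mem_filter, Finset.mem_piAntidiag, Finset.mem_univ, implies_true,
      and_true] at hj
    have hsum : ∑ k, j k = N := hj.1
    simp only [Finset.mem_filter, Fintype.mem_piFinset, Finset.mem_Ico, Finset.sum_add_distrib,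
      Finset.sum_const, Finset.card_univ, Fintype.card_fin, smul_eq_mul, mul_one]
    refine ⟨fun k => ?_, by omega⟩
    have := hj.2 k
    omega
  · intro i hi
    simp only [Finset.mem_filter, Fintype.mem_piFinset, Finset.mem_Ico] at hi
    funext k
    exact Nat.sub_add_cancel (hi.1 k).1
  · intro j _
    funext k
    exact Nat.add_sub_cancel _ _
  · intro i hi
    simp only [Finset.mem_filter, Fintype.mem_piFinset, Finset.mem_Ico] at hi
    exact Finset.prod_congr rfl fun k _ => by rw [Nat.sub_add_cancel (hi.1 k).1]

theorem convPow_one (μ : Measure ℝ) [SFinite μ] : convPow μ 1 = μ := by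
  simp [convPow]

instance isProbabilityMeasure_convPow (μ : Measure ℝ) [IsProbabilityMeasure μ] (n : ℕ) :
    IsProbabilityMeasure (convPow μ n) := by
  induction n with
  | zero => exact inferInstanceAs (IsProbabilityMeasure (Measure.dirac 0))
  | succ n ih => exact inferInstanceAs (IsProbabilityMeasure (Measure.conv (convPow μ n) μ))

theorem lintegral_exp_mul_convPow (μ : Measure ℝ) [IsProbabilityMeasure μ] (s : ℝ) (n : ℕ) :
    ∫⁻ x, ENNReal.ofReal (Real.exp (s * x)) ∂(convPow μ n) =
      (∫⁻ x, ENNReal.ofReal (Real.exp (s * x)) ∂μ) ^ n := by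
  induction n with
  | zero => simp [convPow]
  | succ n ih =>
    rw [convPow, Measure.lintegral_conv (by fun_prop), pow_succ, ← ih,
      ← lintegral_mul_const _ (by fun_prop)]
    refine lintegral_congr fun x => ?_
    rw [← lintegral_const_mul _ (by fun_prop)]
    refine lintegral_congr fun y => ?_
    rw [mul_add, Real.exp_add, ENNReal.ofReal_mul (Real.exp_nonneg _)]

/-- The Chernoff bound for convolution powers. -/
theorem convPow_Iio_le (μ : Measure ℝ) [IsProbabilityMeasure μ] {s : ℝ} (hs : s ≤ 0)
    (hexp : Integrable (fun x => Real.exp (s * x)) μ) (a : ℝ) (n : ℕ) :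
    (convPow μ n (Set.Iio a)).toReal ≤
      Real.exp (-(s * a)) * ProbabilityTheory.mgf id μ s ^ n := by
  have hmarkov := mul_meas_ge_le_lintegral (μ := convPow μ n)
    (f := fun x => ENNReal.ofReal (Real.exp (s * x))) (by fun_prop)
    (ENNReal.ofReal (Real.exp (s * a)))
  have hmgf : ∫⁻ x, ENNReal.ofReal (Real.exp (s * x)) ∂μ =
      ENNReal.ofReal (ProbabilityTheory.mgf id μ s) :=
    (ofReal_integral_eq_lintegral_ofReal hexp (ae_of_all _ fun _ => Real.exp_nonneg _)).symm
  rw [lintegral_exp_mul_convPow, hmgf, ← ENNReal.ofReal_pow ProbabilityTheory.mgf_nonneg] at hmarkov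
  have hsub : Set.Iio a ⊆
      {x | ENNReal.ofReal (Real.exp (s * a)) ≤ ENNReal.ofReal (Real.exp (s * x))} := fun x hx =>
    ENNReal.ofReal_le_ofReal (Real.exp_le_exp.2 (mul_le_mul_of_nonpos_left (le_of_lt hx) hs))
  have hle := (mul_le_mul_right (measure_mono hsub) _).trans hmarkov
  have hreal := ENNReal.toReal_mono ENNReal.ofReal_ne_top hle
  rw [ENNReal.toReal_mul, ENNReal.toReal_ofReal (Real.exp_nonneg _),
    ENNReal.toReal_ofReal (pow_nonneg ProbabilityTheory.mgf_nonneg _)] at hreal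
  rw [Real.exp_neg, inv_mul_eq_div, le_div_iff₀' (Real.exp_pos _)]
  exact hreal

/-- A measure with exponential moments and positive mean has a Laplace transform below `1`. -/
theorem exists_neg_mgf_lt_one (μ : Measure ℝ) [IsProbabilityMeasure μ]
    (hmgf : ∃ ε > (0 : ℝ), ∀ s : ℝ, |s| < ε → Integrable (fun x : ℝ => Real.exp (s * x)) μ)
    (hmean : 0 < ∫ x, x ∂μ) :
    ∃ s < 0, Integrable (fun x => Real.exp (s * x)) μ ∧ ProbabilityTheory.mgf id μ s < 1 := by
  obtain ⟨ε, hε, hexp⟩ := hmgf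
  have hball : Metric.ball (0 : ℝ) ε ⊆ ProbabilityTheory.integrableExpSet id μ := fun s hs =>
    hexp s (by simpa using hs)
  have hderiv := ProbabilityTheory.hasDerivAt_mgf (X := id) (μ := μ) (t := 0)
    (mem_interior.2 ⟨_, hball, Metric.isOpen_ball, Metric.mem_ball_self hε⟩)
  simp only [id, zero_mul, Real.exp_zero, mul_one] at hderiv
  have hslope := (hasDerivAt_iff_tendsto_slope.1 hderiv).mono_left
    (nhdsWithin_mono 0 fun x (hx : x < 0) => hx.ne)
  have hev : ∀ᶠ s in nhdsWithin (0 : ℝ) (Set.Iio 0), s ∈ Set.Ioo (-ε) 0 :=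
    Ioo_mem_nhdsLT (by linarith)
  obtain ⟨s, hs, hpos⟩ := (hev.and (hslope.eventually_const_lt hmean)).exists
  refine ⟨s, hs.2, hexp s (by rw [abs_of_neg hs.2]; linarith [hs.1]), ?_⟩
  rw [slope_def_field, ProbabilityTheory.mgf_zero, sub_zero, div_pos_iff] at hpos
  rcases hpos with h | h <;> linarith [hs.2, h.1, h.2]

/-- **Proposition 4.** Let `μ_t` be the `m`-agent Wild sum
`Σ_{n≥1} b(n) e^{−λt}(1−e^{−(m−1)λt})^{n−1} μ₀^{*[(m−1)(n−1)+1]}` for an initial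
probability measure `μ₀` with moment generating function finite near `0` and strictly
positive mean. Then for every `a` there is `κ > 0` with
`e^{−λt} μ₀((−∞,a)) ≤ μ_t((−∞,a)) ≤ κ^{1/(m−1)} e^{−λt}` for all `t ≥ 0`: the rate of
exponential convergence is `λ`, independent of `m`. -/
theorem wildSum_m_exponential_convergence
    (m : ℕ) (hm : 2 ≤ m) (lam : ℝ) (hlam : 0 < lam)
    (μ₀ : Measure ℝ) [IsProbabilityMeasure μ₀]
    (hmgf : ∃ ε > (0 : ℝ), ∀ s : ℝ, |s| < ε → Integrable (fun x : ℝ => Real.exp (s * x)) μ₀)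
    (hmean : 0 < ∫ x, x ∂μ₀)
    (b : ℕ → ℝ)
    (hb1 : b 1 = 1)
    (hbrec : ∀ n > 1, b n =
      ((m : ℝ) - 1)⁻¹ *
        (1 - ∑ i ∈ (Fintype.piFinset fun _ : Fin (m - 1) => Finset.Ico 1 n).filter
              (fun i => ∑ k, i k = n + m - 2),
            ∏ k, b (i k)))
    (μ : ℝ → Measure ℝ)
    (hμprob : ∀ t ≥ (0 : ℝ), IsProbabilityMeasure (μ t))
    (hμval : ∀ t ≥ (0 : ℝ), ∀ A : Set ℝ, MeasurableSet A →
      ((μ t) A).toReal = ∑' n : ℕ,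
        b (n + 1) * Real.exp (-(lam * t)) *
            (1 - Real.exp (-((m - 1 : ℕ) * lam * t))) ^ n *
          ((convPow μ₀ ((m - 1) * n + 1)) A).toReal) :
    ∀ a : ℝ, ∃ κ > (0 : ℝ), ∀ t ≥ (0 : ℝ),
      Real.exp (-(lam * t)) * (μ₀ (Set.Iio a)).toReal ≤ ((μ t) (Set.Iio a)).toReal ∧
        ((μ t) (Set.Iio a)).toReal ≤ κ ^ ((1 : ℝ) / ((m : ℝ) - 1)) * Real.exp (-(lam * t)) := by
  intro a
  have hp : m - 1 ≠ 0 := by omega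
  have hrec := wildWeight_shifted_recursion hm hbrec
  have hb_nonneg : ∀ n, 0 ≤ b (n + 1) :=
    wildWeight_nonneg hp (c := fun n => b (n + 1)) hb1 hrec
  have hb_le : ∀ n, b (n + 1) ≤ 1 :=
    wildWeight_le_one hp (c := fun n => b (n + 1)) hb1 hrec
  obtain ⟨s, hs, hexp, hlt⟩ := exists_neg_mgf_lt_one μ₀ hmgf hmean
  set ρ := ProbabilityTheory.mgf id μ₀ s with hρ
  have hρpos : 0 < ρ := ProbabilityTheory.mgf_pos hexp
  have hqlt : ρ ^ (m - 1) < 1 := pow_lt_one₀ hρpos.le hlt hp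
  set K := Real.exp (-(s * a)) * (1 - ρ ^ (m - 1))⁻¹ with hK
  have hKpos : 0 < K := mul_pos (Real.exp_pos _) (inv_pos.2 (by linarith))
  have hm1 : (0 : ℝ) < (m : ℝ) - 1 := by
    have : (2 : ℝ) ≤ m := by exact_mod_cast hm
    linarith
  refine ⟨K ^ ((m : ℝ) - 1), Real.rpow_pos_of_pos hKpos _, fun t ht => ?_⟩
  rw [← Real.rpow_mul hKpos.le, mul_one_div_cancel hm1.ne', Real.rpow_one,
    hμval t ht _ measurableSet_Iio]
  set E := Real.exp (-(lam * t)) with hE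
  set z := 1 - Real.exp (-((m - 1 : ℕ) * lam * t)) with hz
  have hEpos : 0 < E := Real.exp_pos _
  have hz0 : 0 ≤ z := sub_nonneg.2 (Real.exp_le_one_iff.2 (neg_nonpos.2 (by positivity)))
  have hz1 : z ≤ 1 := sub_le_self _ (Real.exp_nonneg _)
  set u : ℕ → ℝ := fun n => b (n + 1) * E * z ^ n *
    ((convPow μ₀ ((m - 1) * n + 1)) (Set.Iio a)).toReal with hu
  have hu_nonneg : ∀ n, 0 ≤ u n := fun n =>
    mul_nonneg (mul_nonneg (mul_nonneg (hb_nonneg n) hEpos.le) (pow_nonneg hz0 n))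
      ENNReal.toReal_nonneg
  have hu_le : ∀ n, u n ≤ E * Real.exp (-(s * a)) * (ρ ^ (m - 1)) ^ n := by
    intro n
    have hconv : (convPow μ₀ ((m - 1) * n + 1) (Set.Iio a)).toReal ≤
        Real.exp (-(s * a)) * (ρ ^ (m - 1)) ^ n := by
      refine (convPow_Iio_le μ₀ hs.le hexp a _).trans ?_
      rw [← hρ, pow_succ, pow_mul]
      exact mul_le_mul_of_nonneg_left (mul_le_of_le_one_right (by positivity) hlt.le)
        (Real.exp_nonneg _)
    have hcoef : b (n + 1) * E * z ^ n ≤ E :=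
      (mul_le_of_le_one_right (mul_nonneg (hb_nonneg n) hEpos.le) (pow_le_one₀ hz0 hz1)).trans
        (mul_le_of_le_one_left hEpos.le (hb_le n))
    rw [mul_assoc E]
    exact mul_le_mul hcoef hconv ENNReal.toReal_nonneg hEpos.le
  have hgeom := (hasSum_geometric_of_lt_one (by positivity) hqlt).mul_left
    (E * Real.exp (-(s * a)))
  have hu_sum : Summable u := Summable.of_nonneg_of_le hu_nonneg hu_le hgeom.summable
  constructor
  · have hzero : u 0 = E * (μ₀ (Set.Iio a)).toReal := by
      simp [hu, hb1, convPow_one]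
    rw [← hzero]
    exact hu_sum.le_tsum 0 fun n _ => hu_nonneg n
  · refine (hu_sum.tsum_le_tsum hu_le hgeom.summable).trans_eq ?_
    rw [hgeom.tsum_eq, hK]
    ring
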